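/- Recurrence of the kite network: For any embedded locally finite circle pattern covering all of ℂ, the electrical network on the graph G with conductance μ(e) = H(e)/L(e) (ratio of the kite's diagonal between the two intersection points to the diagonal between the two circle centers) is recurrent. -/

import Mathlib

open Real Metric MeasureTheory ENNReal Function

/-- The area of the rectangle spanned by two orthogonal vectors in the plane. -/
lemma volume_image_square_of_orthogonal (x y : ℂ) (hxy : x.re * y.re + x.im * y.im = 0) :
    volume ((fun z : ℂ => z.re • x + z.im • y) '' {z | z.re ∈ Set.Icc 0 1 ∧ z.im ∈ Set.Icc 0 1}) =
      ENNReal.ofReal (‖x‖ * ‖y‖) := by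
  set T : ℂ →ₗ[ℝ] ℂ := Complex.reLm.smulRight x + Complex.imLm.smulRight y with hT
  have hsq : volume {z : ℂ | z.re ∈ Set.Icc (0 : ℝ) 1 ∧ z.im ∈ Set.Icc (0 : ℝ) 1} = 1 := by
    have h := Complex.volume_preserving_equiv_real_prod.measure_preimage
      (s := Set.Icc (0 : ℝ) 1 ×ˢ Set.Icc (0 : ℝ) 1)
      (measurableSet_Icc.prod measurableSet_Icc).nullMeasurableSet
    change volume {z : ℂ | z.re ∈ Set.Icc (0 : ℝ) 1 ∧ z.im ∈ Set.Icc (0 : ℝ) 1} = _ at h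
    rw [h, Measure.volume_eq_prod, Measure.prod_prod]
    simp
  have hdet : LinearMap.det T = x.re * y.im - x.im * y.re := by
    rw [← LinearMap.det_toMatrix Complex.basisOneI, Matrix.det_fin_two]
    simp [hT, LinearMap.toMatrix_apply, Complex.coe_basisOneI, Complex.coe_basisOneI_repr]
    ring
  have habs : |x.re * y.im - x.im * y.re| = ‖x‖ * ‖y‖ := by
    rw [← abs_of_nonneg (mul_nonneg (norm_nonneg x) (norm_nonneg y)), ← sq_eq_sq_iff_abs_eq_abs,
      mul_pow, Complex.sq_norm, Complex.sq_norm, Complex.normSq_apply, Complex.normSq_apply]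
    linear_combination (-(x.re * y.re + x.im * y.im)) * hxy
  have h := Measure.addHaar_image_linearMap volume T
    {z : ℂ | z.re ∈ Set.Icc (0 : ℝ) 1 ∧ z.im ∈ Set.Icc (0 : ℝ) 1}
  rw [hsq, hdet, habs, mul_one] at h
  exact h

/-- A convex set of the plane and its interior have the same area. -/
lemma volume_le_volume_interior_of_convex {s : Set ℂ} (hs : Convex ℝ s) :
    volume s ≤ volume (interior s) := by
  calc volume s ≤ volume (interior s ∪ frontier s) := by
        rw [← closure_eq_interior_union_frontier]
        exact measure_mono subset_closure
    _ ≤ volume (interior s) + volume (frontier s) := measure_union_le _ _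
    _ = volume (interior s) := by rw [hs.addHaar_frontier volume, add_zero]

/-- The convex hull of a quadrilateral with orthogonal diagonals contains its Varignon rectangle. -/
lemma ofReal_le_volume_interior_convexHull_of_orthogonal (a p w q : ℂ)
    (h : (w - a).re * (q - p).re + (w - a).im * (q - p).im = 0) :
    ENNReal.ofReal (dist w a * dist p q / 4) ≤
      volume (interior (convexHull ℝ {a, p, w, q})) := by
  set S : Set ℂ := convexHull ℝ {a, p, w, q} with hS
  have hconv : Convex ℝ S := convex_convexHull ℝ _
  have hmem : ∀ z ∈ ({a, p, w, q} : Set ℂ), z ∈ S := fun z hz => subset_convexHull ℝ _ hz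
  have hxy : ((1 / 2 : ℝ) • (w - a)).re * ((1 / 2 : ℝ) • (q - p)).re +
      ((1 / 2 : ℝ) • (w - a)).im * ((1 / 2 : ℝ) • (q - p)).im = 0 := by
    simp only [Complex.smul_re, Complex.smul_im, smul_eq_mul]
    linear_combination h / 4
  have key := volume_image_square_of_orthogonal _ _ hxy
  have hval : ‖(1 / 2 : ℝ) • (w - a)‖ * ‖(1 / 2 : ℝ) • (q - p)‖ = dist w a * dist p q / 4 := by
    rw [norm_smul, norm_smul, dist_comm p q, dist_eq_norm, dist_eq_norm]
    norm_num
    ring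
  rw [hval] at key
  refine le_trans ?_ (volume_le_volume_interior_of_convex hconv)
  rw [← key, ← measure_preimage_add volume (-((1 / 2 : ℝ) • (a + p)))]
  refine measure_mono ?_
  rintro z ⟨t, ⟨⟨hs0, hs1⟩, ht0, ht1⟩, hz⟩
  have h1 : (1 - t.re) • a + t.re • w ∈ S :=
    hconv (hmem a (by simp)) (hmem w (by simp)) (by linarith) hs0 (by ring)
  have h2 : (1 - t.im) • p + t.im • q ∈ S :=
    hconv (hmem p (by simp)) (hmem q (by simp)) (by linarith) ht0 (by ring)
  have h3 := hconv h1 h2 (a := 1 / 2) (b := 1 / 2) (by norm_num) (by norm_num) (by norm_num)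
  convert h3 using 1
  simp only [Complex.real_smul] at hz ⊢
  push_cast at hz ⊢
  linear_combination -hz

/-- The part of a kite near the origin is large, provided one of its central triangles has all its
vertices near the origin. -/
lemma ofReal_le_volume_interior_kite_inter_closedBall {a b p q : ℂ} {R : ℝ} (hR : 0 < R)
    (hab : a ≠ b) (ha : dist p a = dist q a) (hb : dist p b = dist q b)
    (haR : ‖a‖ + dist p a ≤ 2 * R) :
    ENNReal.ofReal (dist p q * min (dist a b) R / 4) ≤
      volume (interior (convexHull ℝ {a, p, b, q}) ∩ closedBall 0 (3 * R)) := by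
  have hL : 0 < dist a b := dist_pos.2 hab
  set m := min (dist a b) R with hm
  have hm0 : 0 < m := lt_min hL hR
  set t := m / dist a b with ht
  have ht0 : 0 ≤ t := by positivity
  have ht1 : t ≤ 1 := (div_le_one hL).2 (min_le_left _ _)
  set w : ℂ := a + t • (b - a) with hw
  have hwa : dist w a = m := by
    rw [hw, dist_eq_norm, add_sub_cancel_left, norm_smul, Real.norm_of_nonneg ht0,
      ← dist_eq_norm, dist_comm b a, ht, div_mul_cancel₀ _ hL.ne']
  have hnorm : ∀ z v : ℂ, dist z v ^ 2 = (z.re - v.re) ^ 2 + (z.im - v.im) ^ 2 := by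
    intro z v
    rw [dist_eq_norm, Complex.sq_norm, Complex.normSq_apply, Complex.sub_re, Complex.sub_im]
    ring
  have hperp : (w - a).re * (q - p).re + (w - a).im * (q - p).im = 0 := by
    have h1 := congrArg (· ^ 2) ha
    have h2 := congrArg (· ^ 2) hb
    simp only [hnorm] at h1 h2
    simp only [hw, add_sub_cancel_left, Complex.smul_re, Complex.smul_im, Complex.sub_re,
      Complex.sub_im, smul_eq_mul]
    linear_combination (t / 2) * (h2 - h1)
  have hval : dist p q * m / 4 = dist w a * dist p q / 4 := by rw [hwa, mul_comm]
  rw [hval]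
  refine (ofReal_le_volume_interior_convexHull_of_orthogonal a p w q hperp).trans
    (measure_mono (Set.subset_inter (interior_mono ?_) (interior_subset.trans ?_)))
  · refine convexHull_min ?_ (convex_convexHull ℝ _)
    have hsub := subset_convexHull ℝ ({a, p, b, q} : Set ℂ)
    have hwmem : w ∈ convexHull ℝ ({a, p, b, q} : Set ℂ) :=
      (convex_convexHull ℝ _).add_smul_sub_mem (hsub (by simp)) (hsub (by simp)) ⟨ht0, ht1⟩
    rintro z (rfl | rfl | rfl | rfl)
    · exact hsub (by simp)
    · exact hsub (by simp)
    · exact hwmem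
    · exact hsub (by simp)
  · refine convexHull_min ?_ (convex_closedBall 0 (3 * R))
    have hmR : m ≤ R := min_le_right _ _
    have hnn : 0 ≤ dist p a := dist_nonneg
    have hdist : ∀ z : ℂ, ‖z‖ ≤ ‖a‖ + dist z a := fun z => by
      rw [dist_eq_norm]
      simpa using norm_add_le a (z - a)
    have hp := hdist p
    have hq := hdist q
    have hw' := hdist w
    have ha' := norm_nonneg a
    rintro z (rfl | rfl | rfl | rfl) <;> rw [mem_closedBall_zero_iff] <;> linarith

/-- Planar sets indexed by the edges of a graph, with disjoint sets for distinct edges, cover a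
region at most twice when every edge is counted with both orientations. -/
lemma tsum_volume_inter_le_two_mul {V : Type*} (G : SimpleGraph V) (K : V → V → Set ℂ) (B : Set ℂ)
    (hB : MeasurableSet B) (hK : ∀ u v, MeasurableSet (K u v))
    (hdisj : ∀ u v u' v', G.Adj u v → G.Adj u' v' → s(u, v) ≠ s(u', v') → K u v ∩ K u' v' = ∅) :
    ∑' e : {e : V × V // G.Adj e.1 e.2}, volume (K e.1.1 e.1.2 ∩ B) ≤ 2 * volume B := by
  classical
  let _ : LinearOrder V := linearOrderOfSTO WellOrderingRel
  have key : ∀ (P : V → V → Prop) [DecidableRel P], (∀ u v, P u v → ¬ P v u) →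
      ∑' e : {e : V × V // G.Adj e.1 e.2},
        volume (if P e.1.1 e.1.2 then K e.1.1 e.1.2 ∩ B else ∅) ≤ volume B := by
    intro P _ hP
    refine (tsum_meas_le_meas_iUnion_of_disjoint volume ?_ ?_).trans
      (measure_mono (Set.iUnion_subset ?_))
    · intro e
      split_ifs
      · exact (hK _ _).inter hB
      · exact MeasurableSet.empty
    · rintro ⟨⟨u, v⟩, huv⟩ ⟨⟨u', v'⟩, huv'⟩ hne
      simp only [Function.onFun]
      split_ifs with h1 h2
      · refine Disjoint.mono Set.inter_subset_left Set.inter_subset_left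
          (Set.disjoint_iff_inter_eq_empty.2 (hdisj u v u' v' huv huv' fun h => ?_))
        rcases Sym2.eq_iff.1 h with ⟨rfl, rfl⟩ | ⟨rfl, rfl⟩
        · exact hne rfl
        · exact hP _ _ h1 h2
      all_goals simp
    · intro e
      split_ifs
      · exact Set.inter_subset_right
      · exact Set.empty_subset _
  calc ∑' e : {e : V × V // G.Adj e.1 e.2}, volume (K e.1.1 e.1.2 ∩ B)
      ≤ ∑' e : {e : V × V // G.Adj e.1 e.2},
          (volume (if e.1.1 < e.1.2 then K e.1.1 e.1.2 ∩ B else ∅) +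
            volume (if e.1.2 < e.1.1 then K e.1.1 e.1.2 ∩ B else ∅)) := by
        refine ENNReal.tsum_le_tsum fun e => ?_
        rcases lt_or_gt_of_ne e.2.ne with h | h
        · rw [if_pos h]
          exact le_self_add
        · rw [if_pos h]
          exact le_add_self
    _ ≤ volume B + volume B := by
        rw [ENNReal.tsum_add]
        exact add_le_add (key (fun u v => u < v) fun u v h => h.not_gt)
          (key (fun u v => v < u) fun u v h => h.not_gt)
    _ = 2 * volume B := (two_mul _).symm

/-- The piecewise linear cutoff on the half-line, equal to `1` up to `R` and to `0` from `2 * R`. -/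
noncomputable def radialCutoff (R t : ℝ) : ℝ := max 0 (min 1 (2 - t / R))

lemma radialCutoff_nonneg (R t : ℝ) : 0 ≤ radialCutoff R t := le_max_left _ _

lemma radialCutoff_le_one (R t : ℝ) : radialCutoff R t ≤ 1 :=
  max_le zero_le_one (min_le_left _ _)

lemma radialCutoff_eq_one {R t : ℝ} (hR : 0 < R) (h : t ≤ R) : radialCutoff R t = 1 := by
  have : t / R ≤ 1 := (div_le_one hR).2 h
  rw [radialCutoff, min_eq_left (by linarith), max_eq_right zero_le_one]

lemma radialCutoff_eq_zero {R t : ℝ} (hR : 0 < R) (h : 2 * R ≤ t) : radialCutoff R t = 0 := by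
  have : 2 ≤ t / R := (le_div_iff₀ hR).2 h
  exact max_eq_left ((min_le_right _ _).trans (by linarith))

lemma abs_radialCutoff_sub_le {R : ℝ} (hR : 0 < R) (s t : ℝ) :
    |radialCutoff R s - radialCutoff R t| ≤ |s - t| / R := by
  unfold radialCutoff
  rw [max_comm 0, max_comm 0, min_comm 1, min_comm 1]
  refine (abs_max_sub_max_le_abs _ _ _).trans ?_
  refine (abs_min_sub_min_le_max _ _ _ _).trans ?_
  have h : 2 - s / R - (2 - t / R) = -((s - t) / R) := by ring
  rw [sub_self, abs_zero, max_eq_left (abs_nonneg _), h, abs_neg, abs_div, abs_of_pos hR]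

/-- The distance from the origin of the farthest point of a circle is a Lipschitz function along
the edges of a circle pattern. -/
lemma abs_norm_add_sub_norm_add_le {a b p : ℂ} {s t : ℝ} (hs : dist p a = s) (ht : dist p b = t) :
    |(‖a‖ + s) - (‖b‖ + t)| ≤ 2 * dist a b := by
  have h1 : |‖a‖ - ‖b‖| ≤ dist a b := by
    rw [dist_eq_norm]
    exact abs_norm_sub_norm_le a b
  have h2 : |s - t| ≤ dist a b := by
    rw [← hs, ← ht, dist_comm p a, dist_comm p b]
    exact abs_dist_sub_le a b p
  rw [abs_le] at *
  constructor <;> linarith [h1.1, h1.2, h2.1, h2.2]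

/-- The energy which a radial cutoff assigns to an edge is controlled by the area of the part of
the kite near the origin. -/
lemma ofReal_energy_radialCutoff_le {a b p q : ℂ} {s t R : ℝ} (hR : 0 < R) (hab : a ≠ b)
    (hpa : dist p a = s) (hqa : dist q a = s) (hpb : dist p b = t) (hqb : dist q b = t) :
    ENNReal.ofReal (1 / 2 * (dist p q / dist a b) *
        (radialCutoff R (‖a‖ + s) - radialCutoff R (‖b‖ + t)) ^ 2) ≤
      ENNReal.ofReal (8 / R ^ 2) *
        volume (interior (convexHull ℝ {a, p, b, q}) ∩ closedBall 0 (3 * R)) := by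
  wlog haR : ‖a‖ + s ≤ 2 * R generalizing a b s t
  · by_cases hbR : ‖b‖ + t ≤ 2 * R
    · have h := this hab.symm hpb hqb hpa hqa hbR
      have hset : ({b, p, a, q} : Set ℂ) = {a, p, b, q} := by
        ext z
        simp only [Set.mem_insert_iff, Set.mem_singleton_iff]
        tauto
      rwa [hset, dist_comm b a, sub_sq_comm] at h
    · rw [radialCutoff_eq_zero hR (not_le.1 haR).le, radialCutoff_eq_zero hR (not_le.1 hbR).le]
      simp
  have hL : 0 < dist a b := dist_pos.2 hab
  have hH : 0 ≤ dist p q := dist_nonneg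
  set m := min (dist a b) R with hm
  set d := radialCutoff R (‖a‖ + s) - radialCutoff R (‖b‖ + t) with hd
  have hd1 : |d| ≤ 1 := by
    rw [abs_le]
    constructor <;> linarith [radialCutoff_nonneg R (‖a‖ + s), radialCutoff_nonneg R (‖b‖ + t),
      radialCutoff_le_one R (‖a‖ + s), radialCutoff_le_one R (‖b‖ + t)]
  have hd2 : |d| ≤ 2 * dist a b / R := (abs_radialCutoff_sub_le hR _ _).trans
    (div_le_div_of_nonneg_right (abs_norm_add_sub_norm_add_le hpa hpb) hR.le)
  have hdm : d ^ 2 ≤ 4 * (dist a b * m / R ^ 2) := by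
    rw [← sq_abs]
    rcases le_total (dist a b) R with h | h
    · rw [hm, min_eq_left h]
      calc |d| ^ 2 ≤ (2 * dist a b / R) ^ 2 := pow_le_pow_left₀ (abs_nonneg _) hd2 2
        _ = _ := by ring
    · rw [hm, min_eq_right h]
      have h1 : |d| ^ 2 ≤ 1 := pow_le_one₀ (abs_nonneg _) hd1
      have h2 : dist a b * R / R ^ 2 = dist a b / R := by field_simp
      have h3 : 1 ≤ dist a b / R := (one_le_div hR).2 h
      rw [h2]
      linarith
  have hreal : 1 / 2 * (dist p q / dist a b) * d ^ 2 ≤ 8 / R ^ 2 * (dist p q * m / 4) := by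
    calc 1 / 2 * (dist p q / dist a b) * d ^ 2
        ≤ 1 / 2 * (dist p q / dist a b) * (4 * (dist a b * m / R ^ 2)) := by gcongr
      _ = 8 / R ^ 2 * (dist p q * m / 4) := by
        field_simp
        ring
  refine (ENNReal.ofReal_le_ofReal hreal).trans ?_
  rw [ENNReal.ofReal_mul (by positivity)]
  gcongr
  exact ofReal_le_volume_interior_kite_inter_closedBall hR hab (hpa.trans hqa.symm)
    (hpb.trans hqb.symm) (by rwa [hpa])

/-- The Dirichlet energy of a function on the vertices of a weighted graph. -/
noncomputable def dirichletEnergy {V : Type*} (G : SimpleGraph V) (μ : V → V → ℝ) (g : V → ℝ) :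
    ℝ≥0∞ :=
  ∑' e : {e : V × V // G.Adj e.1 e.2},
    ENNReal.ofReal (1 / 2 * μ e.1.1 e.1.2 * (g e.1.1 - g e.1.2) ^ 2)

/-- If the cutoffs of `ψ` have uniformly bounded energy and only finitely many edges start below
each level of `ψ`, then summing cutoffs at widely separated levels produces functions whose energy
grows at most linearly in their value at `v₀`. -/
lemma exists_dirichletEnergy_le_of_cutoffs {V : Type*} (G : SimpleGraph V) (μ : V → V → ℝ)
    (ψ : V → ℝ)
    (hfin : ∀ M : ℝ, {e : V × V | G.Adj e.1 e.2 ∧ ψ e.1 < M}.Finite) (C : ℝ≥0∞)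
    (hcut : ∀ R : ℝ, 0 < R → dirichletEnergy G μ (fun v => radialCutoff R (ψ v)) ≤ C)
    (v₀ : V) (n : ℕ) :
    ∃ (g : V → ℝ) (M : ℝ), 0 < M ∧ ψ v₀ ≤ M ∧ (∀ v, M ≤ ψ v → g v = 0) ∧ g v₀ = n ∧
      (∀ u v, G.Adj u v → g u ≠ g v → ψ u ≤ M ∧ ψ v ≤ M) ∧
      dirichletEnergy G μ g ≤ n * C := by
  induction n with
  | zero =>
    exact ⟨fun _ => 0, max 1 (ψ v₀), lt_max_of_lt_left one_pos, le_max_right _ _, fun _ _ => rfl,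
      by simp, fun _ _ _ h => absurd rfl h, by simp [dirichletEnergy]⟩
  | succ n ih =>
    obtain ⟨g, M, hM, hM₀, hg0, hgn, hgM, hgE⟩ := ih
    set f : V → ℝ := fun v => radialCutoff M (ψ v) with hf
    obtain ⟨N, hN⟩ := ((hfin (2 * M)).image fun e => max (ψ e.1) (ψ e.2)).bddAbove
    have hN' : ∀ u v, G.Adj u v → ψ u < 2 * M → ψ u ≤ N ∧ ψ v ≤ N := fun u v huv hu =>
      max_le_iff.1 (hN ⟨(u, v), ⟨huv, hu⟩, rfl⟩)
    have hf1 : ∀ v, ψ v ≤ M → f v = 1 := fun v hv => radialCutoff_eq_one hM hv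
    have hf0 : ∀ v, 2 * M ≤ ψ v → f v = 0 := fun v hv => radialCutoff_eq_zero hM hv
    have hle : 2 * M ≤ max (2 * M) N := le_max_left _ _
    refine ⟨fun v => g v + f v, max (2 * M) N, by linarith, by linarith, ?_, ?_, ?_, ?_⟩
    · intro v hv
      linarith [hg0 v (by linarith), hf0 v (by linarith)]
    · push_cast
      linarith [hf1 v₀ hM₀]
    · intro u v huv hne
      by_cases hgne : g u = g v
      · have hfne : f u ≠ f v := fun h => hne (congrArg₂ (· + ·) hgne h)
        have hor : ψ u < 2 * M ∨ ψ v < 2 * M := by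
          by_contra! h
          exact hfne (by rw [hf0 u h.1, hf0 v h.2])
        rcases hor with h | h
        · have := hN' u v huv h
          exact ⟨le_max_of_le_right this.1, le_max_of_le_right this.2⟩
        · have := hN' v u huv.symm h
          exact ⟨le_max_of_le_right this.2, le_max_of_le_right this.1⟩
      · have := hgM u v huv hgne
        exact ⟨by linarith [this.1], by linarith [this.2]⟩
    · calc dirichletEnergy G μ (fun v => g v + f v)
          ≤ dirichletEnergy G μ g + dirichletEnergy G μ f := by
            unfold dirichletEnergy
            rw [← ENNReal.tsum_add]
            refine ENNReal.tsum_le_tsum fun ⟨⟨u, v⟩, huv⟩ => ?_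
            by_cases hgne : g u = g v
            · simp [hgne]
            · have := hgM u v huv hgne
              simp [hf1 u this.1, hf1 v this.2]
        _ ≤ n * C + C := add_le_add hgE (hcut M hM)
        _ = (n + 1 : ℕ) * C := by
            push_cast
            rw [add_mul, one_mul]

/-- **Recurrence of the kite network.**
For an embedded locally finite circle pattern covering all of `ℂ` (circles of radius `r v`
centered at `c v`; for each edge the two intersection points `p u v`, `q u v`; kites
`K u v = convexHull {c u, p u v, c v, q u v}` with pairwise disjoint interiors, covering `ℂ`,
locally finite), the electrical network on `G` with conductance
`μ(e) = H(e)/L(e) = dist(p,q)/dist(c u, c v)` is recurrent; i.e., for every vertex `v₀`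
there are finitely supported potentials `g` with `g v₀ = 1` and arbitrarily small energy. -/
theorem kite_network_recurrent
    {V : Type*} (G : SimpleGraph V) (c : V → ℂ) (r : V → ℝ) (p q : V → V → ℂ)
    (hr : ∀ v, 0 < r v)
    (hcc : ∀ u v, G.Adj u v → c u ≠ c v)
    (hpsymm : ∀ u v, p u v = p v u) (hqsymm : ∀ u v, q u v = q v u)
    (hint : ∀ u v, G.Adj u v →
      dist (p u v) (c u) = r u ∧ dist (p u v) (c v) = r v ∧
      dist (q u v) (c u) = r u ∧ dist (q u v) (c v) = r v ∧ p u v ≠ q u v)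
    (hembed : ∀ u v u' v', G.Adj u v → G.Adj u' v' → s(u, v) ≠ s(u', v') →
      interior (convexHull ℝ {c u, p u v, c v, q u v}) ∩
        interior (convexHull ℝ {c u', p u' v', c v', q u' v'}) = ∅)
    (hcover : ∀ z : ℂ, ∃ u v, G.Adj u v ∧ z ∈ convexHull ℝ {c u, p u v, c v, q u v})
    (hlocfin : ∀ K : Set ℂ, IsCompact K →
      {e : V × V | G.Adj e.1 e.2 ∧
        ((convexHull ℝ {c e.1, p e.1 e.2, c e.2, q e.1 e.2}) ∩ K).Nonempty}.Finite) :
    ∀ v₀ : V, ∀ ε : ℝ, 0 < ε →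
      ∃ g : V → ℝ, (Function.support g).Finite ∧ g v₀ = 1 ∧
        (∑' e : {e : V × V // G.Adj e.1 e.2},
          ENNReal.ofReal ((1 / 2) *
            (dist (p e.1.1 e.1.2) (q e.1.1 e.1.2) / dist (c e.1.1) (c e.1.2)) *
            (g e.1.1 - g e.1.2) ^ 2)) ≤ ENNReal.ofReal ε := by
  intro v₀ ε hε
  set ψ : V → ℝ := fun v => ‖c v‖ + r v with hψ
  set μ : V → V → ℝ := fun u v => dist (p u v) (q u v) / dist (c u) (c v) with hμ
  have hfin : ∀ M : ℝ, {e : V × V | G.Adj e.1 e.2 ∧ ψ e.1 < M}.Finite := by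
    intro M
    refine (hlocfin (closedBall 0 M) (isCompact_closedBall 0 M)).subset ?_
    rintro ⟨u, v⟩ ⟨huv, hu⟩
    refine ⟨huv, c u, subset_convexHull ℝ _ (by simp), ?_⟩
    rw [mem_closedBall_zero_iff]
    have := hr u
    simp only [hψ] at hu
    linarith
  have hcut : ∀ R : ℝ, 0 < R →
      dirichletEnergy G μ (fun v => radialCutoff R (ψ v)) ≤ ENNReal.ofReal (144 * π) := by
    intro R hR
    have hball : volume (closedBall (0 : ℂ) (3 * R)) = ENNReal.ofReal (9 * R ^ 2 * π) := by
      rw [Complex.volume_closedBall, ← ENNReal.ofReal_pow (by positivity), ENNReal.ofReal_mul (by positivity),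
        ← NNReal.coe_real_pi, ENNReal.ofReal_coe_nnreal]
      norm_num [mul_pow]
    calc dirichletEnergy G μ (fun v => radialCutoff R (ψ v))
        ≤ ∑' e : {e : V × V // G.Adj e.1 e.2}, ENNReal.ofReal (8 / R ^ 2) *
            volume (interior (convexHull ℝ
              {c e.1.1, p e.1.1 e.1.2, c e.1.2, q e.1.1 e.1.2}) ∩ closedBall 0 (3 * R)) := by
          refine ENNReal.tsum_le_tsum fun ⟨⟨u, v⟩, huv⟩ => ?_
          obtain ⟨h1, h2, h3, h4, -⟩ := hint u v huv
          exact ofReal_energy_radialCutoff_le hR (hcc u v huv) h1 h3 h2 h4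
      _ ≤ ENNReal.ofReal (8 / R ^ 2) * (2 * volume (closedBall (0 : ℂ) (3 * R))) := by
          rw [ENNReal.tsum_mul_left]
          gcongr
          exact tsum_volume_inter_le_two_mul G
            (fun u v => interior (convexHull ℝ {c u, p u v, c v, q u v})) _
            measurableSet_closedBall (fun u v => isOpen_interior.measurableSet) hembed
      _ = ENNReal.ofReal (144 * π) := by
          rw [hball, ← ENNReal.ofReal_ofNat 2, ← ENNReal.ofReal_mul (by positivity),
            ← ENNReal.ofReal_mul (by positivity)]
          congr 1
          field_simp
          norm_num
  obtain ⟨k, hk⟩ := exists_nat_gt (144 * π / ε)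
  have hk0 : (0 : ℝ) < k := lt_trans (by positivity) hk
  obtain ⟨g, M, -, -, hg0, hgn, -, hgE⟩ :=
    exists_dirichletEnergy_le_of_cutoffs G μ ψ hfin _ hcut v₀ k
  classical
  refine ⟨fun v => if (∃ u, G.Adj v u) ∨ v = v₀ then g v / k else 0, ?_, ?_, ?_⟩
  · refine (((hfin M).image Prod.fst).insert v₀).subset fun v hv => ?_
    rw [Function.mem_support, ne_eq, ite_eq_right_iff, Classical.not_imp] at hv
    obtain ⟨⟨u, huv⟩ | h, hne⟩ := hv
    · refine Or.inr ⟨(v, u), ⟨huv, ?_⟩, rfl⟩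
      by_contra! h
      exact hne (by rw [hg0 v h, zero_div])
    · exact Or.inl h
  · simp [hgn, hk0.ne']
  · have hscale : ∀ e : {e : V × V // G.Adj e.1 e.2},
        ENNReal.ofReal ((1 / 2) * (dist (p e.1.1 e.1.2) (q e.1.1 e.1.2) /
          dist (c e.1.1) (c e.1.2)) *
          ((if (∃ u, G.Adj e.1.1 u) ∨ e.1.1 = v₀ then g e.1.1 / k else 0) -
            (if (∃ u, G.Adj e.1.2 u) ∨ e.1.2 = v₀ then g e.1.2 / k else 0)) ^ 2) =
        ENNReal.ofReal (1 / (k : ℝ) ^ 2) *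
          ENNReal.ofReal (1 / 2 * μ e.1.1 e.1.2 * (g e.1.1 - g e.1.2) ^ 2) := by
      rintro ⟨⟨u, v⟩, huv⟩
      rw [if_pos (Or.inl ⟨v, huv⟩), if_pos (Or.inl ⟨u, huv.symm⟩),
        ← ENNReal.ofReal_mul (by positivity)]
      congr 1
      simp only [hμ]
      field_simp
    rw [tsum_congr hscale, ENNReal.tsum_mul_left]
    calc ENNReal.ofReal (1 / (k : ℝ) ^ 2) * dirichletEnergy G μ g
        ≤ ENNReal.ofReal (1 / (k : ℝ) ^ 2) * (k * ENNReal.ofReal (144 * π)) := by gcongr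
      _ = ENNReal.ofReal (144 * π / k) := by
          rw [← ENNReal.ofReal_natCast, ← ENNReal.ofReal_mul hk0.le,
            ← ENNReal.ofReal_mul (by positivity)]
          congr 1
          field_simp
      _ ≤ ENNReal.ofReal ε := by
          refine ENNReal.ofReal_le_ofReal ?_
          rw [div_lt_iff₀ hε] at hk
          rw [div_le_iff₀ hk0]
          linarith
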